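/- Let U ⊆ ℝ⁴ be open and let g = (g_{αβ}) : U → ℝ^{4×4} be a smooth map whose values are symmetric and invertible matrices, with inverse entries g^{αβ}. Define the Christoffel symbols Γ^λ_{αβ} = (1/2) g^{λλ'} (∂_α g_{βλ'} + ∂_β g_{αλ'} − ∂_{λ'} g_{αβ}), the Ricci tensor R_{αβ} = ∂_λ Γ^λ_{αβ} − ∂_α Γ^λ_{βλ} + Γ^λ_{αβ} Γ^δ_{λδ} − Γ^λ_{αδ} Γ^δ_{βλ}, and the contracted quantities Γ^γ = g^{αβ} Γ^γ_{αβ} and Γ_λ = g_{λγ} Γ^γ. Then one has the identity R_{αβ} = −(1/2) g^{λδ} ∂_λ ∂_δ g_{αβ} + (1/2)(∂_α Γ_β + ∂_β Γ_α) + (1/2) F_{αβ}, where F_{αβ} = P_{αβ} + Q_{αβ} + W_{αβ} with: the quasi-null term P_{αβ} = −(1/2) g^{λλ'} g^{δδ'} ∂_α g_{δλ'} ∂_β g_{λδ'} + (1/4) g^{δδ'} g^{λλ'} ∂_β g_{δδ'} ∂_α g_{λλ'}; the null term Q_{αβ} = g^{λλ'} g^{δδ'} ∂_δ g_{αλ'}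 ∂_{δ'} g_{βλ} − g^{λλ'} g^{δδ'} ( ∂_δ g_{αλ'} ∂_λ g_{βδ'} − ∂_δ g_{βδ'} ∂_λ g_{αλ'} ) + g^{λλ'} g^{δδ'} ( ∂_α g_{λ'δ'} ∂_δ g_{λβ} − ∂_α g_{λβ} ∂_δ g_{λ'δ'} ) + (1/2) g^{λλ'} g^{δδ'} ( ∂_α g_{λβ} ∂_{λ'} g_{δδ'} − ∂_α g_{δδ'} ∂_{λ'} g_{λβ} ) + g^{λλ'} g^{δδ'} ( ∂_β g_{λ'δ'} ∂_δ g_{λα} − ∂_β g_{λα} ∂_δ g_{λ'δ'} ) + (1/2) g^{λλ'} g^{δδ'} ( ∂_β g_{λα} ∂_{λ'} g_{δδ'} − ∂_β g_{δδ'} ∂_{λ'} g_{λα} ); and the remainder W_{αβ} = g^{δδ'} ∂_δ g_{αβ} Γ_{δ'} − Γ_α Γ_β. (All Greek indices run over 0,1,2,3 with implicit summation over repeated indices.) -/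

import Mathlib

noncomputable section
open scoped BigOperators

/-- Partial derivative `∂_α` of a scalar function on `ℝ⁴`. -/
def pd4 (α : Fin 4) (f : (Fin 4 → ℝ) → ℝ) : (Fin 4 → ℝ) → ℝ :=
  fun x => fderiv ℝ f x (Pi.single α 1)

/-- The entry `g_{αβ}` of a metric, as a scalar function. -/
def gc (g : (Fin 4 → ℝ) → Matrix (Fin 4) (Fin 4) ℝ) (α β : Fin 4) :
    (Fin 4 → ℝ) → ℝ :=
  fun x => g x α β

/-- The entry `g^{αβ}` of the pointwise inverse metric. -/
def ginv (g : (Fin 4 → ℝ) → Matrix (Fin 4) (Fin 4) ℝ) (α β : Fin 4) :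
    (Fin 4 → ℝ) → ℝ :=
  fun x => (g x)⁻¹ α β

/-- The Christoffel symbols
`Γ^λ_{αβ} = (1/2) g^{λλ'} (∂_α g_{βλ'} + ∂_β g_{αλ'} − ∂_{λ'} g_{αβ})`. -/
def Chr (g : (Fin 4 → ℝ) → Matrix (Fin 4) (Fin 4) ℝ) (lam α β : Fin 4) :
    (Fin 4 → ℝ) → ℝ :=
  fun x => (1 / 2) * ∑ lam' : Fin 4, ginv g lam lam' x *
    (pd4 α (gc g β lam') x + pd4 β (gc g α lam') x - pd4 lam' (gc g α β) x)

/-- The Ricci tensor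
`R_{αβ} = ∂_λ Γ^λ_{αβ} − ∂_α Γ^λ_{βλ} + Γ^λ_{αβ} Γ^δ_{λδ} − Γ^λ_{αδ} Γ^δ_{βλ}`. -/
def Ricci (g : (Fin 4 → ℝ) → Matrix (Fin 4) (Fin 4) ℝ) (α β : Fin 4) :
    (Fin 4 → ℝ) → ℝ :=
  fun x =>
    (∑ lam : Fin 4, pd4 lam (Chr g lam α β) x)
    - (∑ lam : Fin 4, pd4 α (Chr g lam β lam) x)
    + (∑ lam : Fin 4, ∑ δ : Fin 4, Chr g lam α β x * Chr g δ lam δ x)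
    - (∑ lam : Fin 4, ∑ δ : Fin 4, Chr g lam α δ x * Chr g δ β lam x)

/-- The contracted Christoffel symbol `Γ^γ = g^{αβ} Γ^γ_{αβ}`. -/
def ChrUp (g : (Fin 4 → ℝ) → Matrix (Fin 4) (Fin 4) ℝ) (γ : Fin 4) :
    (Fin 4 → ℝ) → ℝ :=
  fun x => ∑ α : Fin 4, ∑ β : Fin 4, ginv g α β x * Chr g γ α β x

/-- The lowered contracted Christoffel symbol `Γ_λ = g_{λγ} Γ^γ`. -/
def ChrLow (g : (Fin 4 → ℝ) → Matrix (Fin 4) (Fin 4) ℝ) (lam : Fin 4) :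
    (Fin 4 → ℝ) → ℝ :=
  fun x => ∑ γ : Fin 4, gc g lam γ x * ChrUp g γ x

/-- The quasi-null term `P_{αβ}`. -/
def Pterm (g : (Fin 4 → ℝ) → Matrix (Fin 4) (Fin 4) ℝ) (α β : Fin 4) :
    (Fin 4 → ℝ) → ℝ :=
  fun x =>
    ∑ lam : Fin 4, ∑ lam' : Fin 4, ∑ δ : Fin 4, ∑ δ' : Fin 4,
      ( -(1 / 2) * ginv g lam lam' x * ginv g δ δ' x *
          pd4 α (gc g δ lam') x * pd4 β (gc g lam δ') x
        + (1 / 4) * ginv g δ δ' x * ginv g lam lam' x *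
            pd4 β (gc g δ δ') x * pd4 α (gc g lam lam') x )

/-- The null term `Q_{αβ}`. -/
def Qterm (g : (Fin 4 → ℝ) → Matrix (Fin 4) (Fin 4) ℝ) (α β : Fin 4) :
    (Fin 4 → ℝ) → ℝ :=
  fun x =>
    ∑ lam : Fin 4, ∑ lam' : Fin 4, ∑ δ : Fin 4, ∑ δ' : Fin 4,
      ( ginv g lam lam' x * ginv g δ δ' x *
          pd4 δ (gc g α lam') x * pd4 δ' (gc g β lam) x
        - ginv g lam lam' x * ginv g δ δ' x *
            (pd4 δ (gc g α lam') x * pd4 lam (gc g β δ') x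
              - pd4 δ (gc g β δ') x * pd4 lam (gc g α lam') x)
        + ginv g lam lam' x * ginv g δ δ' x *
            (pd4 α (gc g lam' δ') x * pd4 δ (gc g lam β) x
              - pd4 α (gc g lam β) x * pd4 δ (gc g lam' δ') x)
        + (1 / 2) * ginv g lam lam' x * ginv g δ δ' x *
            (pd4 α (gc g lam β) x * pd4 lam' (gc g δ δ') x
              - pd4 α (gc g δ δ') x * pd4 lam' (gc g lam β) x)
        + ginv g lam lam' x * ginv g δ δ' x *
            (pd4 β (gc g lam' δ') x * pd4 δ (gc g lam α) x
              - pd4 β (gc g lam α) x * pd4 δ (gc g lam' δ') x)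
        + (1 / 2) * ginv g lam lam' x * ginv g δ δ' x *
            (pd4 β (gc g lam α) x * pd4 lam' (gc g δ δ') x
              - pd4 β (gc g δ δ') x * pd4 lam' (gc g lam α) x) )

/-- The remainder term `W_{αβ} = g^{δδ'} ∂_δ g_{αβ} Γ_{δ'} − Γ_α Γ_β`. -/
def Wterm (g : (Fin 4 → ℝ) → Matrix (Fin 4) (Fin 4) ℝ) (α β : Fin 4) :
    (Fin 4 → ℝ) → ℝ :=
  fun x =>
    (∑ δ : Fin 4, ∑ δ' : Fin 4, ginv g δ δ' x * pd4 δ (gc g α β) x * ChrLow g δ' x)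
      - ChrLow g α x * ChrLow g β x
section Contraction

variable {ι : Type*} [Fintype ι]

/-- Full contraction `I^{lm} Y_{lm}` of a two-index array. -/
def contract₂ (I : ι → ι → ℝ) (Y : ι → ι → ℝ) : ℝ :=
  ∑ l, ∑ m, I l m * Y l m

/-- Double contraction `I^{lm} I^{de} F_{lmde}` of a four-index array. -/
def contract₄ (I : ι → ι → ℝ) (F : ι → ι → ι → ι → ℝ) : ℝ :=
  ∑ l, ∑ m, ∑ d, ∑ e, I l m * I d e * F l m d e

variable {I : ι → ι → ℝ}

lemma contract₂_swap (hI : ∀ a b, I a b = I b a) (Y : ι → ι → ℝ) :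
    contract₂ I Y = contract₂ I fun l m => Y m l := by
  unfold contract₂
  rw [Finset.sum_comm]
  simp only [hI]

lemma contract₂_add (Y Z : ι → ι → ℝ) :
    contract₂ I (fun l m => Y l m + Z l m) = contract₂ I Y + contract₂ I Z := by
  simp only [contract₂, mul_add, Finset.sum_add_distrib]

lemma contract₂_sub (Y Z : ι → ι → ℝ) :
    contract₂ I (fun l m => Y l m - Z l m) = contract₂ I Y - contract₂ I Z := by
  simp only [contract₂, mul_sub, Finset.sum_sub_distrib]

lemma contract₂_mul_left (c : ℝ) (Y : ι → ι → ℝ) :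
    contract₂ I (fun l m => c * Y l m) = c * contract₂ I Y := by
  simp only [contract₂, Finset.mul_sum, mul_left_comm]

lemma contract₄_eq_contract₂ (F : ι → ι → ι → ι → ℝ) :
    contract₄ I F = contract₂ I fun l m => contract₂ I fun d e => F l m d e := by
  simp only [contract₄, contract₂, Finset.mul_sum, mul_assoc]

lemma contract₄_add (F F' : ι → ι → ι → ι → ℝ) :
    contract₄ I (fun l m d e => F l m d e + F' l m d e) = contract₄ I F + contract₄ I F' := by
  simp only [contract₄, mul_add, Finset.sum_add_distrib]

lemma contract₄_sub (F F' : ι → ι → ι → ι → ℝ) :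
    contract₄ I (fun l m d e => F l m d e - F' l m d e) = contract₄ I F - contract₄ I F' := by
  simp only [contract₄, mul_sub, Finset.sum_sub_distrib]

lemma contract₄_mul_left (c : ℝ) (F : ι → ι → ι → ι → ℝ) :
    contract₄ I (fun l m d e => c * F l m d e) = c * contract₄ I F := by
  simp only [contract₄, Finset.mul_sum, mul_left_comm]

lemma contract₄_swap_fst (hI : ∀ a b, I a b = I b a) (F : ι → ι → ι → ι → ℝ) :
    contract₄ I F = contract₄ I fun l m d e => F m l d e := by
  simp only [contract₄_eq_contract₂]
  exact contract₂_swap hI _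

lemma contract₄_swap_snd (hI : ∀ a b, I a b = I b a) (F : ι → ι → ι → ι → ℝ) :
    contract₄ I F = contract₄ I fun l m d e => F l m e d := by
  simp only [contract₄_eq_contract₂]
  congr 1
  funext l m
  exact contract₂_swap hI _

lemma contract₄_swap_pairs (F : ι → ι → ι → ι → ℝ) :
    contract₄ I F = contract₄ I fun l m d e => F d e l m := by
  have h : ∀ G : ι → ι → ι → ι → ℝ, contract₄ I G =
      ∑ p : ι × ι, ∑ q : ι × ι, I p.1 p.2 * I q.1 q.2 * G p.1 p.2 q.1 q.2 := fun G => by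
    simp only [contract₄, Fintype.sum_prod_type]
  rw [h, h, Finset.sum_comm]
  simp only [mul_comm (I _ _) (I _ _)]

/-- An equality of contractions holds as soon as it holds after symmetrization. -/
lemma contract₂_congr_symm (hI : ∀ a b, I a b = I b a) {Y Z : ι → ι → ℝ}
    (h : ∀ l m, Y l m + Y m l = Z l m + Z m l) : contract₂ I Y = contract₂ I Z := by
  have key : ∀ X : ι → ι → ℝ, contract₂ I (fun l m => X l m + X m l) = 2 * contract₂ I X :=
    fun X => by rw [contract₂_add, ← contract₂_swap hI]; ring
  have := key Y
  simp only [h, key] at this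
  linarith

/-- An equality of double contractions holds as soon as it holds after symmetrization over the
eight permutations preserving the pairing of indices. -/
lemma contract₄_congr_symm (hI : ∀ a b, I a b = I b a) {F G : ι → ι → ι → ι → ℝ}
    (h : ∀ l m d e,
      F l m d e + F m l d e + (F l m e d + F m l e d)
        + (F d e l m + F e d l m + (F d e m l + F e d m l))
      = G l m d e + G m l d e + (G l m e d + G m l e d)
        + (G d e l m + G e d l m + (G d e m l + G e d m l))) :
    contract₄ I F = contract₄ I G := by
  have k₁ : ∀ X : ι → ι → ι → ι → ℝ,
      contract₄ I (fun l m d e => X l m d e + X m l d e) = 2 * contract₄ I X :=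
    fun X => by rw [contract₄_add, ← contract₄_swap_fst hI]; ring
  have k₂ : ∀ X : ι → ι → ι → ι → ℝ,
      contract₄ I (fun l m d e => X l m d e + X l m e d) = 2 * contract₄ I X :=
    fun X => by rw [contract₄_add, ← contract₄_swap_snd hI]; ring
  have k₃ : ∀ X : ι → ι → ι → ι → ℝ,
      contract₄ I (fun l m d e => X l m d e + X d e l m) = 2 * contract₄ I X :=
    fun X => by rw [contract₄_add, ← contract₄_swap_pairs]; ring
  have key : ∀ X : ι → ι → ι → ι → ℝ, contract₄ I (fun l m d e =>
      X l m d e + X m l d e + (X l m e d + X m l e d)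
        + (X d e l m + X e d l m + (X d e m l + X e d m l))) = 8 * contract₄ I X := fun X => by
    rw [k₃ fun l m d e => X l m d e + X m l d e + (X l m e d + X m l e d),
      k₂ fun l m d e => X l m d e + X m l d e, k₁]
    ring
  have := key F
  simp only [h, key] at this
  linarith

lemma contract₂_mul_contract₂ (Y Z : ι → ι → ℝ) :
    contract₂ I Y * contract₂ I Z = contract₄ I fun l m d e => Y l m * Z d e := by
  rw [contract₄_eq_contract₂]
  simp only [contract₂_mul_left]
  simp only [contract₂, Finset.sum_mul, mul_assoc]

lemma sum_mul_sum_eq_contract₄ (X Y : ι → ι → ι → ℝ) :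
    ∑ l, ∑ d, ((1 / 2) * ∑ m, I l m * X l d m) * ((1 / 2) * ∑ e, I d e * Y l d e)
      = contract₄ I fun l m d e => (1 / 4) * (X l d m * Y l d e) := by
  unfold contract₄
  refine Finset.sum_congr rfl fun l _ => ?_
  rw [Finset.sum_comm]
  refine Finset.sum_congr rfl fun d _ => ?_
  rw [mul_mul_mul_comm, Finset.sum_mul_sum, Finset.mul_sum]
  refine Finset.sum_congr rfl fun m _ => ?_
  rw [Finset.mul_sum]
  refine Finset.sum_congr rfl fun e _ => ?_
  ring

lemma sum_deriv_inv_mul_eq_contract₄ (E : ι → ι → ι → ℝ) (X : ι → ι → ℝ) :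
    ∑ l, ∑ m, (-∑ a, ∑ b, I l a * E l a b * I b m) * X l m
      = contract₄ I fun l m d e => -(E l m d * X l e) := by
  unfold contract₄
  refine Finset.sum_congr rfl fun l _ => ?_
  simp only [← Finset.sum_neg_distrib, Finset.sum_mul]
  rw [Finset.sum_comm]
  refine Finset.sum_congr rfl fun a _ => ?_
  rw [Finset.sum_comm]
  refine Finset.sum_congr rfl fun b _ => Finset.sum_congr rfl fun m _ => ?_
  ring

/-- The Christoffel symbols of the first kind, times two, of an array `D a b c` of derivatives
`∂_a g_{bc}`. -/
def christoffelFirst (D : ι → ι → ι → ℝ) (a b c : ι) : ℝ :=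
  D a b c + D b a c - D c a b

/-- The integrand of the lowered contracted Christoffel symbol `Γ_c = g^{ab} (∂_a g_{bc}
- (1/2) ∂_c g_{ab})`. -/
def loweredChristoffel (D : ι → ι → ι → ℝ) (c a b : ι) : ℝ :=
  D a b c - (1 / 2) * D c a b

/-- The second-order part of the decomposition of the Ricci tensor. -/
lemma contract₂_ricci (hI : ∀ a b, I a b = I b a) (H : ι → ι → ι → ι → ℝ)
    (hH : ∀ a b c d, H a b c d = H b a c d) (hH' : ∀ a b c d, H a b c d = H a b d c) (α β : ι) :
    (1 / 2) * contract₂ I (fun l m => christoffelFirst (H l) α β m)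
        - (1 / 2) * contract₂ I (fun l m => christoffelFirst (H α) β l m)
      = -(1 / 2) * contract₂ I (fun l m => H l m α β)
        + (1 / 2) * (contract₂ I (fun l m => loweredChristoffel (H α) β l m)
          + contract₂ I (fun l m => loweredChristoffel (H β) α l m)) := by
  simp only [← contract₂_mul_left, ← contract₂_add, ← contract₂_sub]
  refine contract₂_congr_symm hI fun l m => ?_
  have e₁ : H l α β m = H α l β m := hH ..
  have e₂ : H m α β l = H α m β l := hH ..
  have e₃ : H l β α m = H β l α m := hH ..
  have e₄ : H m β α l = H β m α l := hH ..
  have e₅ : H β α l m = H α β l m := hH ..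
  have e₆ : H α β m l = H α β l m := hH' ..
  have e₇ : H β α m l = H α β l m := by rw [hH', hH]
  have e₈ : H α l m β = H α l β m := hH' ..
  have e₉ : H α m l β = H α m β l := hH' ..
  have e₁₀ : H β l m α = H β l α m := hH' ..
  have e₁₁ : H β m l α = H β m α l := hH' ..
  have e₁₂ : H m l α β = H l m α β := hH ..
  simp only [christoffelFirst, loweredChristoffel, e₁, e₂, e₃, e₄, e₅, e₆, e₇, e₈, e₉, e₁₀, e₁₁,
    e₁₂]
  ring

/-- The first-order part of the decomposition of the Ricci tensor. -/
lemma contract₄_ricci (hI : ∀ a b, I a b = I b a) (D : ι → ι → ι → ℝ)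
    (hD : ∀ a b c, D a b c = D a c b) (α β : ι) :
    (1 / 2) * contract₄ I (fun l m d e => -(D l m d * christoffelFirst D α β e))
        - (1 / 2) * contract₄ I (fun l m d e => -(D α m d * christoffelFirst D β l e))
        + contract₄ I (fun l m d e =>
            (1 / 4) * (christoffelFirst D α β m * christoffelFirst D l d e))
        - contract₄ I (fun l m d e =>
            (1 / 4) * (christoffelFirst D α d m * christoffelFirst D β l e))
      = (1 / 2) * (contract₄ I (fun l m d e => -(D α m d * loweredChristoffel D β l e))
          + contract₄ I (fun l m d e => -(D β m d * loweredChristoffel D α l e)))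
        + (1 / 2) * (contract₄ I (fun l m d e =>
              -(1 / 2) * (D α d m * D β l e) + (1 / 4) * (D β d e * D α l m))
          + contract₄ I (fun l m d e =>
              D d α m * D e β l - (D d α m * D l β e - D d β e * D l α m)
              + (D α m e * D d l β - D α l β * D d m e)
              + (1 / 2) * (D α l β * D m d e - D α d e * D m l β)
              + (D β m e * D d l α - D β l α * D d m e)
              + (1 / 2) * (D β l α * D m d e - D β d e * D m l α))
          + (contract₄ I (fun l m d e => D l α β * loweredChristoffel D m d e)
            - contract₄ I (fun l m d e =>
                loweredChristoffel D α l m * loweredChristoffel D β d e))) := by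
  simp only [← contract₄_mul_left, ← contract₄_add, ← contract₄_sub]
  refine contract₄_congr_symm hI fun l m d e => ?_
  simp only [christoffelFirst, loweredChristoffel, hD]
  ring

end Contraction

section PartialDerivative

variable {f h : (Fin 4 → ℝ) → ℝ} {x : Fin 4 → ℝ}

lemma pd4_mul (a : Fin 4) (hf : DifferentiableAt ℝ f x) (hh : DifferentiableAt ℝ h x) :
    pd4 a (fun y => f y * h y) x = pd4 a f x * h x + f x * pd4 a h x := by
  simp only [pd4, fderiv_fun_mul hf hh]
  simp
  ring

lemma pd4_const_mul (a : Fin 4) (c : ℝ) (hf : DifferentiableAt ℝ f x) :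
    pd4 a (fun y => c * f y) x = c * pd4 a f x := by
  simp [pd4, fderiv_const_mul hf]

lemma pd4_add (a : Fin 4) (hf : DifferentiableAt ℝ f x) (hh : DifferentiableAt ℝ h x) :
    pd4 a (fun y => f y + h y) x = pd4 a f x + pd4 a h x := by
  simp [pd4, fderiv_fun_add hf hh]

lemma pd4_sub (a : Fin 4) (hf : DifferentiableAt ℝ f x) (hh : DifferentiableAt ℝ h x) :
    pd4 a (fun y => f y - h y) x = pd4 a f x - pd4 a h x := by
  simp [pd4, fderiv_fun_sub hf hh]

lemma pd4_sum {ι : Type*} [Fintype ι] {F : ι → (Fin 4 → ℝ) → ℝ} (a : Fin 4)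
    (hF : ∀ i, DifferentiableAt ℝ (F i) x) :
    pd4 a (fun y => ∑ i, F i y) x = ∑ i, pd4 a (F i) x := by
  simp [pd4, fderiv_fun_sum fun i _ => hF i]

lemma pd4_congr (a : Fin 4) (hfh : f =ᶠ[nhds x] h) : pd4 a f x = pd4 a h x := by
  simp only [pd4, hfh.fderiv_eq]

lemma differentiableAt_pd4 (a : Fin 4) (hf : ContDiffAt ℝ (⊤ : ℕ∞) f x) :
    DifferentiableAt ℝ (pd4 a f) x := by
  have : ContDiffAt ℝ 1 (fderiv ℝ f) x :=
    hf.fderiv_right (by norm_cast)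
  exact (this.differentiableAt one_ne_zero).clm_apply (differentiableAt_const _)

lemma pd4_comm (a b : Fin 4) (hf : ContDiffAt ℝ (⊤ : ℕ∞) f x) :
    pd4 a (pd4 b f) x = pd4 b (pd4 a f) x := by
  have hd : DifferentiableAt ℝ (fderiv ℝ f) x :=
    (hf.fderiv_right (m := 1) (by norm_cast)).differentiableAt one_ne_zero
  have hs : IsSymmSndFDerivAt ℝ f x := hf.isSymmSndFDerivAt (by simp; norm_cast)
  have key : ∀ u v : Fin 4, pd4 u (pd4 v f) x
      = fderiv ℝ (fderiv ℝ f) x (Pi.single u 1) (Pi.single v 1) := fun u v => by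
    change fderiv ℝ (fun y => fderiv ℝ f y (Pi.single v 1)) x (Pi.single u 1) = _
    rw [fderiv_clm_apply hd (differentiableAt_const _)]
    simp
  rw [key, key]
  exact hs _ _

end PartialDerivative

section InverseMatrix

variable {E : Type*} [NormedAddCommGroup E] [NormedSpace ℝ E] {n : Type*} [Fintype n]
  [DecidableEq n] {A : E → Matrix n n ℝ} {x : E}

lemma differentiableAt_matrix_det (hA : ∀ i j, DifferentiableAt ℝ (fun y => A y i j) x) :
    DifferentiableAt ℝ (fun y => (A y).det) x := by
  simp only [Matrix.det_apply, Units.smul_def, zsmul_eq_mul]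
  fun_prop

lemma differentiableAt_matrix_inv_apply (hA : ∀ i j, DifferentiableAt ℝ (fun y => A y i j) x)
    (hx : IsUnit (A x)) (i j : n) : DifferentiableAt ℝ (fun y => (A y)⁻¹ i j) x := by
  have hdet : (A x).det ≠ 0 := ((Matrix.isUnit_iff_isUnit_det _).1 hx).ne_zero
  simp only [Matrix.inv_def, Ring.inverse_eq_inv', Matrix.smul_apply, smul_eq_mul,
    Matrix.adjugate_apply]
  refine ((differentiableAt_matrix_det hA).inv hdet).mul (differentiableAt_matrix_det fun k l => ?_)
  simp only [Matrix.updateRow_apply]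
  split_ifs
  · exact differentiableAt_const _
  · exact hA k l

end InverseMatrix

section Metric

variable {g : (Fin 4 → ℝ) → Matrix (Fin 4) (Fin 4) ℝ} {x : Fin 4 → ℝ}

lemma ginv_symm (hsymm : ∀ a b, g x a b = g x b a) (a b : Fin 4) :
    ginv g a b x = ginv g b a x := by
  have hT : (g x).transpose = g x := by
    ext a b
    exact hsymm b a
  calc ginv g a b x = ((g x).transpose)⁻¹ a b := by rw [hT, ginv]
    _ = ginv g b a x := by rw [← Matrix.transpose_nonsing_inv, Matrix.transpose_apply, ginv]

lemma sum_ginv_mul_gc (hinv : IsUnit (g x)) (a b : Fin 4) :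
    ∑ c, ginv g a c x * gc g c b x = if a = b then 1 else 0 := by
  have := congrFun₂ (Matrix.nonsing_inv_mul (g x) ((Matrix.isUnit_iff_isUnit_det _).1 hinv)) a b
  rwa [Matrix.mul_apply, Matrix.one_apply] at this

lemma sum_gc_mul_ginv (hinv : IsUnit (g x)) (a b : Fin 4) :
    ∑ c, gc g a c x * ginv g c b x = if a = b then 1 else 0 := by
  have := congrFun₂ (Matrix.mul_nonsing_inv (g x) ((Matrix.isUnit_iff_isUnit_det _).1 hinv)) a b
  rwa [Matrix.mul_apply, Matrix.one_apply] at this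

lemma differentiableAt_ginv (hg : ∀ a b, DifferentiableAt ℝ (gc g a b) x)
    (hinv : IsUnit (g x)) (a b : Fin 4) : DifferentiableAt ℝ (ginv g a b) x :=
  differentiableAt_matrix_inv_apply hg hinv a b

/-- The derivative of the inverse metric: `∂_k g^{lm} = - g^{la} ∂_k g_{ab} g^{bm}`. -/
lemma pd4_ginv (hg : ∀ a b, DifferentiableAt ℝ (gc g a b) x)
    (hinv : ∀ᶠ y in nhds x, IsUnit (g y)) (k l m : Fin 4) :
    pd4 k (ginv g l m) x
      = -∑ a, ∑ b, ginv g l a x * pd4 k (gc g a b) x * ginv g b m x := by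
  have hx := hinv.self_of_nhds
  have hi := differentiableAt_ginv hg hx
  have hzero : ∀ b, ∑ a, (pd4 k (ginv g l a) x * gc g a b x
      + ginv g l a x * pd4 k (gc g a b) x) = 0 := fun b => by
    have h := pd4_congr k (hinv.mono fun y hy => sum_ginv_mul_gc hy l b)
    rw [pd4_sum k fun a => (hi l a).fun_mul (hg a b)] at h
    simp only [fun a => pd4_mul k (hi l a) (hg a b)] at h
    rw [h]
    simp [pd4]
  have hsum : ∑ b, (∑ a, (pd4 k (ginv g l a) x * gc g a b x
      + ginv g l a x * pd4 k (gc g a b) x)) * ginv g b m x = 0 := by simp [hzero]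
  have hfirst : ∑ a, pd4 k (ginv g l a) x * ∑ b, gc g a b x * ginv g b m x
      = pd4 k (ginv g l m) x := by simp [sum_gc_mul_ginv hx]
  rw [← hfirst, eq_neg_iff_add_eq_zero, ← hsum]
  simp only [Finset.sum_mul, Finset.mul_sum]
  rw [Finset.sum_comm, Finset.sum_comm (f := fun a b => _ * pd4 k (gc g a b) x * _),
    ← Finset.sum_add_distrib]
  refine Finset.sum_congr rfl fun b _ => ?_
  rw [← Finset.sum_add_distrib]
  refine Finset.sum_congr rfl fun a _ => ?_
  ring

/-- Derivative of the contraction of an array of functions with the inverse metric. -/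
lemma sum_pd4_sum_ginv_mul (hg : ∀ a b, DifferentiableAt ℝ (gc g a b) x)
    (hinv : ∀ᶠ y in nhds x, IsUnit (g y)) (k : Fin 4 → Fin 4)
    {X : Fin 4 → Fin 4 → (Fin 4 → ℝ) → ℝ} (hX : ∀ l m, DifferentiableAt ℝ (X l m) x) :
    ∑ l, pd4 (k l) (fun y => ∑ m, ginv g l m y * X l m y) x
      = contract₄ (fun a b => ginv g a b x)
          (fun l m d e => -(pd4 (k l) (gc g m d) x * X l e x))
        + contract₂ (fun a b => ginv g a b x) (fun l m => pd4 (k l) (X l m) x) := by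
  have hi := differentiableAt_ginv hg hinv.self_of_nhds
  rw [← sum_deriv_inv_mul_eq_contract₄ (fun l a b => pd4 (k l) (gc g a b) x), contract₂,
    ← Finset.sum_add_distrib]
  refine Finset.sum_congr rfl fun l _ => ?_
  rw [pd4_sum _ fun m => (hi l m).fun_mul (hX l m), ← Finset.sum_add_distrib]
  refine Finset.sum_congr rfl fun m _ => ?_
  rw [pd4_mul _ (hi l m) (hX l m), pd4_ginv hg hinv]

lemma chrLow_eq_contract₂ (hsymm : ∀ a b, g x a b = g x b a) (hinv : IsUnit (g x))
    (c : Fin 4) :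
    ChrLow g c x = contract₂ (fun a b => ginv g a b x)
      fun a b => loweredChristoffel (fun a b c => pd4 a (gc g b c) x) c a b := by
  have hlow : ∀ a b, ∑ γ, gc g c γ x * Chr g γ a b x
      = (1 / 2) * christoffelFirst (fun a b c => pd4 a (gc g b c) x) a b c := fun a b => by
    have h : ∑ e, (∑ γ, gc g c γ x * ginv g γ e x)
          * christoffelFirst (fun a b c => pd4 a (gc g b c) x) a b e
        = christoffelFirst (fun a b c => pd4 a (gc g b c) x) a b c := by
      simp [sum_gc_mul_ginv hinv]
    rw [← h, Finset.mul_sum]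
    simp only [Chr, christoffelFirst, Finset.mul_sum, Finset.sum_mul]
    rw [Finset.sum_comm]
    refine Finset.sum_congr rfl fun e _ => Finset.sum_congr rfl fun γ _ => ?_
    ring
  have h : ChrLow g c x = contract₂ (fun a b => ginv g a b x)
      fun a b => ∑ γ, gc g c γ x * Chr g γ a b x := by
    simp only [ChrLow, ChrUp, contract₂, Finset.mul_sum]
    rw [Finset.sum_comm]
    refine Finset.sum_congr rfl fun a _ => ?_
    rw [Finset.sum_comm]
    refine Finset.sum_congr rfl fun b _ => Finset.sum_congr rfl fun γ _ => ?_
    ring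
  rw [h]
  refine contract₂_congr_symm (ginv_symm hsymm) fun a b => ?_
  simp only [hlow, christoffelFirst, loweredChristoffel]
  ring

lemma pd4_gc_symm (hsymm : ∀ᶠ y in nhds x, ∀ a b, g y a b = g y b a) (a b c : Fin 4) :
    pd4 a (gc g b c) x = pd4 a (gc g c b) x :=
  pd4_congr a (hsymm.mono fun _ hy => hy b c)

lemma pd4_pd4_gc_symm (hsymm : ∀ᶠ y in nhds x, ∀ a b, g y a b = g y b a) (a b c d : Fin 4) :
    pd4 a (pd4 b (gc g c d)) x = pd4 a (pd4 b (gc g d c)) x :=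
  pd4_congr a (hsymm.eventually_nhds.mono fun _ hy => pd4_gc_symm hy b c d)

lemma differentiableAt_christoffelFirst (hg : ∀ a b, ContDiffAt ℝ (⊤ : ℕ∞) (gc g a b) x)
    (a b c : Fin 4) :
    DifferentiableAt ℝ (fun y => christoffelFirst (fun a b c => pd4 a (gc g b c) y) a b c) x :=
  ((differentiableAt_pd4 _ (hg _ _)).add (differentiableAt_pd4 _ (hg _ _))).sub
    (differentiableAt_pd4 _ (hg _ _))

lemma pd4_christoffelFirst (hg : ∀ a b, ContDiffAt ℝ (⊤ : ℕ∞) (gc g a b) x)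
    (k a b c : Fin 4) :
    pd4 k (fun y => christoffelFirst (fun a b c => pd4 a (gc g b c) y) a b c) x
      = christoffelFirst (fun a b c => pd4 k (pd4 a (gc g b c)) x) a b c := by
  have h := fun a b c => differentiableAt_pd4 a (hg b c)
  simp only [christoffelFirst]
  rw [pd4_sub k ((h _ _ _).fun_add (h _ _ _)) (h _ _ _), pd4_add k (h _ _ _) (h _ _ _)]

lemma differentiableAt_loweredChristoffel (hg : ∀ a b, ContDiffAt ℝ (⊤ : ℕ∞) (gc g a b) x)
    (c a b : Fin 4) :
    DifferentiableAt ℝ (fun y => loweredChristoffel (fun a b c => pd4 a (gc g b c) y) c a b) x :=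
  (differentiableAt_pd4 _ (hg _ _)).sub ((differentiableAt_pd4 _ (hg _ _)).const_mul _)

lemma pd4_loweredChristoffel (hg : ∀ a b, ContDiffAt ℝ (⊤ : ℕ∞) (gc g a b) x)
    (k c a b : Fin 4) :
    pd4 k (fun y => loweredChristoffel (fun a b c => pd4 a (gc g b c) y) c a b) x
      = loweredChristoffel (fun a b c => pd4 k (pd4 a (gc g b c)) x) c a b := by
  have h := fun a b c => differentiableAt_pd4 a (hg b c)
  simp only [loweredChristoffel]
  rw [pd4_sub k (h _ _ _) ((h _ _ _).const_mul _), pd4_const_mul k _ (h _ _ _)]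

lemma pd4_chrLow (hg : ∀ a b, ContDiffAt ℝ (⊤ : ℕ∞) (gc g a b) x)
    (hsymm : ∀ᶠ y in nhds x, ∀ a b, g y a b = g y b a)
    (hinv : ∀ᶠ y in nhds x, IsUnit (g y)) (k c : Fin 4) :
    pd4 k (ChrLow g c) x
      = contract₄ (fun a b => ginv g a b x) (fun l m d e => -(pd4 k (gc g m d) x
            * loweredChristoffel (fun a b c => pd4 a (gc g b c) x) c l e))
        + contract₂ (fun a b => ginv g a b x)
            (fun l m => loweredChristoffel (fun a b c => pd4 k (pd4 a (gc g b c)) x) c l m) := by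
  have hd : ∀ a b, DifferentiableAt ℝ (gc g a b) x := fun a b =>
    (hg a b).differentiableAt (by simp)
  have hi := differentiableAt_ginv hd hinv.self_of_nhds
  have hL := differentiableAt_loweredChristoffel hg c
  rw [pd4_congr k ((hsymm.and hinv).mono fun y hy => chrLow_eq_contract₂ hy.1 hy.2 c)]
  simp only [contract₂]
  rw [pd4_sum k fun l => DifferentiableAt.fun_sum fun m _ => (hi l m).fun_mul (hL l m),
    sum_pd4_sum_ginv_mul hd hinv (fun _ => k) hL]
  simp only [pd4_loweredChristoffel hg, contract₂]

lemma sum_pd4_chr (hg : ∀ a b, ContDiffAt ℝ (⊤ : ℕ∞) (gc g a b) x)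
    (hinv : ∀ᶠ y in nhds x, IsUnit (g y)) (k a b : Fin 4 → Fin 4) :
    ∑ l, pd4 (k l) (Chr g l (a l) (b l)) x
      = (1 / 2) * contract₄ (fun a b => ginv g a b x) (fun l m d e => -(pd4 (k l) (gc g m d) x
            * christoffelFirst (fun a b c => pd4 a (gc g b c) x) (a l) (b l) e))
        + (1 / 2) * contract₂ (fun a b => ginv g a b x) (fun l m =>
            christoffelFirst (fun a b c => pd4 (k l) (pd4 a (gc g b c)) x) (a l) (b l) m) := by
  have hd : ∀ a b, DifferentiableAt ℝ (gc g a b) x := fun a b =>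
    (hg a b).differentiableAt (by simp)
  have hi := differentiableAt_ginv hd hinv.self_of_nhds
  have hS := differentiableAt_christoffelFirst hg
  have h := sum_pd4_sum_ginv_mul hd hinv k fun l m => hS (a l) (b l) m
  simp only [pd4_christoffelFirst hg] at h
  rw [← mul_add, ← h, Finset.mul_sum]
  refine Finset.sum_congr rfl fun l _ => ?_
  exact pd4_const_mul (k l) (1 / 2) (DifferentiableAt.fun_sum fun m _ => (hi l m).fun_mul (hS _ _ m))

lemma ricci_eq_contract (hg : ∀ a b, ContDiffAt ℝ (⊤ : ℕ∞) (gc g a b) x)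
    (hinv : ∀ᶠ y in nhds x, IsUnit (g y)) (α β : Fin 4) :
    letI I : Fin 4 → Fin 4 → ℝ := fun a b => ginv g a b x
    letI D : Fin 4 → Fin 4 → Fin 4 → ℝ := fun a b c => pd4 a (gc g b c) x
    letI H : Fin 4 → Fin 4 → Fin 4 → Fin 4 → ℝ := fun k a b c => pd4 k (pd4 a (gc g b c)) x
    Ricci g α β x
      = (1 / 2) * contract₄ I (fun l m d e => -(D l m d * christoffelFirst D α β e))
        + (1 / 2) * contract₂ I (fun l m => christoffelFirst (H l) α β m)
        - ((1 / 2) * contract₄ I (fun l m d e => -(D α m d * christoffelFirst D β l e))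
          + (1 / 2) * contract₂ I (fun l m => christoffelFirst (H α) β l m))
        + contract₄ I (fun l m d e =>
            (1 / 4) * (christoffelFirst D α β m * christoffelFirst D l d e))
        - contract₄ I (fun l m d e =>
            (1 / 4) * (christoffelFirst D α d m * christoffelFirst D β l e)) := by
  rw [Ricci, sum_pd4_chr hg hinv (fun l => l) (fun _ => α) (fun _ => β),
    sum_pd4_chr hg hinv (fun _ => α) (fun _ => β) (fun l => l)]
  congr 1
  · congr 1
    exact sum_mul_sum_eq_contract₄
      (fun _ _ m => christoffelFirst (fun a b c => pd4 a (gc g b c) x) α β m)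
      (fun l d e => christoffelFirst (fun a b c => pd4 a (gc g b c) x) l d e)
  · exact sum_mul_sum_eq_contract₄
      (fun _ d m => christoffelFirst (fun a b c => pd4 a (gc g b c) x) α d m)
      (fun l _ e => christoffelFirst (fun a b c => pd4 a (gc g b c) x) β l e)

lemma pterm_eq_contract₄ (α β : Fin 4) :
    letI D : Fin 4 → Fin 4 → Fin 4 → ℝ := fun a b c => pd4 a (gc g b c) x
    Pterm g α β x = contract₄ (fun a b => ginv g a b x) fun l m d e =>
      -(1 / 2) * (D α d m * D β l e) + (1 / 4) * (D β d e * D α l m) := by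
  refine Finset.sum_congr rfl fun l _ => Finset.sum_congr rfl fun m _ =>
    Finset.sum_congr rfl fun d _ => Finset.sum_congr rfl fun e _ => ?_
  ring

lemma qterm_eq_contract₄ (α β : Fin 4) :
    letI D : Fin 4 → Fin 4 → Fin 4 → ℝ := fun a b c => pd4 a (gc g b c) x
    Qterm g α β x = contract₄ (fun a b => ginv g a b x) fun l m d e =>
      D d α m * D e β l - (D d α m * D l β e - D d β e * D l α m)
        + (D α m e * D d l β - D α l β * D d m e)
        + (1 / 2) * (D α l β * D m d e - D α d e * D m l β)
        + (D β m e * D d l α - D β l α * D d m e)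
        + (1 / 2) * (D β l α * D m d e - D β d e * D m l α) := by
  refine Finset.sum_congr rfl fun l _ => Finset.sum_congr rfl fun m _ =>
    Finset.sum_congr rfl fun d _ => Finset.sum_congr rfl fun e _ => ?_
  ring

lemma wterm_eq_contract₄ (hsymm : ∀ a b, g x a b = g x b a) (hinv : IsUnit (g x))
    (α β : Fin 4) :
    letI I : Fin 4 → Fin 4 → ℝ := fun a b => ginv g a b x
    letI D : Fin 4 → Fin 4 → Fin 4 → ℝ := fun a b c => pd4 a (gc g b c) x
    Wterm g α β x = contract₄ I (fun l m d e => D l α β * loweredChristoffel D m d e)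
      - contract₄ I (fun l m d e =>
          loweredChristoffel D α l m * loweredChristoffel D β d e) := by
  rw [← contract₂_mul_contract₂, contract₄_eq_contract₂]
  simp only [Wterm, chrLow_eq_contract₂ hsymm hinv, contract₂_mul_left]
  simp only [contract₂, mul_assoc]

end Metric

/-- Decomposition of the Ricci curvature in coordinates:
`R_{αβ} = −(1/2) g^{λδ} ∂_λ∂_δ g_{αβ} + (1/2)(∂_α Γ_β + ∂_β Γ_α) + (1/2) F_{αβ}`
with `F_{αβ} = P_{αβ} + Q_{αβ} + W_{αβ}`, valid on any open set where the
(symmetric, invertible) metric `g` is smooth. -/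
theorem stmt19 (U : Set (Fin 4 → ℝ)) (hU : IsOpen U)
    (g : (Fin 4 → ℝ) → Matrix (Fin 4) (Fin 4) ℝ)
    (hsmooth : ∀ α β : Fin 4, ContDiffOn ℝ (⊤ : ℕ∞) (gc g α β) U)
    (hsymm : ∀ x ∈ U, ∀ α β : Fin 4, g x α β = g x β α)
    (hinv : ∀ x ∈ U, IsUnit (g x)) :
    ∀ α β : Fin 4, ∀ x ∈ U,
      Ricci g α β x =
        -(1 / 2) * (∑ lam : Fin 4, ∑ δ : Fin 4,
            ginv g lam δ x * pd4 lam (pd4 δ (gc g α β)) x)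
          + (1 / 2) * (pd4 α (ChrLow g β) x + pd4 β (ChrLow g α) x)
          + (1 / 2) * (Pterm g α β x + Qterm g α β x + Wterm g α β x) := by
  intro α β x hx
  have hU' : U ∈ nhds x := hU.mem_nhds hx
  have hg : ∀ a b, ContDiffAt ℝ (⊤ : ℕ∞) (gc g a b) x := fun a b =>
    (hsmooth a b).contDiffAt hU'
  have hsymm' : ∀ᶠ y in nhds x, ∀ a b, g y a b = g y b a :=
    Filter.mem_of_superset hU' hsymm
  have hinv' : ∀ᶠ y in nhds x, IsUnit (g y) := Filter.mem_of_superset hU' hinv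
  have hI := ginv_symm (hsymm x hx)
  have h₂ := contract₂_ricci hI (fun a b c d => pd4 a (pd4 b (gc g c d)) x)
    (fun a b c d => pd4_comm a b (hg c d)) (pd4_pd4_gc_symm hsymm') α β
  have h₄ := contract₄_ricci hI (fun a b c => pd4 a (gc g b c) x) (pd4_gc_symm hsymm') α β
  rw [ricci_eq_contract hg hinv', pd4_chrLow hg hsymm' hinv', pd4_chrLow hg hsymm' hinv',
    pterm_eq_contract₄, qterm_eq_contract₄, wterm_eq_contract₄ (hsymm x hx) (hinv x hx)]
  have hH : ∑ l, ∑ m, ginv g l m x * pd4 l (pd4 m (gc g α β)) x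
      = contract₂ (fun a b => ginv g a b x) fun l m => pd4 l (pd4 m (gc g α β)) x := rfl
  rw [hH]
  linear_combination h₂ + h₄
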